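/- arXiv:1401.2333 — 2 statements merged into one kernel-verified Lean document; each statement's English description precedes it below -/
import Mathlib

section
/- Connectedness of the centralizer of the translation: every orientation preserving homeomorphism Φ of ℝ² satisfying Φ∘T = T∘Φ is isotopic to the identity through homeomorphisms commuting with T; that is, there exists a continuous map F : [0,1] × ℝ² → ℝ² with F(0,·) = id, F(1,·) = Φ, and such that for every t, F(t,·) is a homeomorphism of ℝ² commuting with T. -/
open Set

/-- The plane. -/
abbrev Plane : Type := ℝ × ℝ

/-- `f` is (the underlying function of) a homeomorphism of the plane. -/
def IsHomeoFun (f : Plane → Plane) : Prop :=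
  ∃ e : Plane ≃ₜ Plane, ∀ x, e x = f x

/-- `g` and `g'` are isotopic relative to `O` : there is a continuous family
`F (t, ·)`, `t ∈ [0,1]`, of homeomorphisms of the plane going from `g` to `g'`
and agreeing with `g` on `O` for all times. -/
def IsotopicRel (g g' : Plane → Plane) (O : Set Plane) : Prop :=
  ∃ F : ℝ × Plane → Plane, Continuous F ∧
    (∀ t ∈ Icc (0:ℝ) 1, IsHomeoFun fun x => F (t, x)) ∧
    (∀ x, F (0, x) = g x) ∧
    (∀ x, F (1, x) = g' x) ∧
    (∀ t ∈ Icc (0:ℝ) 1, ∀ x ∈ O, F (t, x) = g x)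

/-- A homeomorphism of the plane is orientation preserving iff it is isotopic
to the identity. -/
def OrientationPreserving (h : Plane ≃ₜ Plane) : Prop :=
  IsotopicRel id (⇑h) (∅ : Set Plane)

/-- A Brouwer homeomorphism: orientation preserving and fixed point free. -/
def IsBrouwer (h : Plane ≃ₜ Plane) : Prop :=
  OrientationPreserving h ∧ ∀ x, h x ≠ x

/-- The orbit of a point under a homeomorphism. -/
def horbit (h : Plane ≃ₜ Plane) (x : Plane) : Set Plane :=
  {y | ∃ n : ℤ, y = (h.toEquiv ^ n) x}

/-- `ℤ₁ = ℤ × {1}`. -/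
def Z1 : Set Plane := {p | ∃ n : ℤ, p = ((n : ℝ), 1)}

/-- `ℤ₂ = ℤ × {2}`. -/
def Z2 : Set Plane := {p | ∃ n : ℤ, p = ((n : ℝ), 2)}

/-- The shear homeomorphism `(x, y) ↦ (x + f y, y)`. -/
def shear (f : ℝ → ℝ) (hf : Continuous f) : Plane ≃ₜ Plane where
  toFun p := (p.1 + f p.2, p.2)
  invFun p := (p.1 - f p.2, p.2)
  left_inv p := by simp
  right_inv p := by simp
  continuous_toFun := (continuous_fst.add (hf.comp continuous_snd)).prodMk continuous_snd
  continuous_invFun := (continuous_fst.sub (hf.comp continuous_snd)).prodMk continuous_snd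

/-- The translation `T (x, y) = (x + 1, y)`. -/
def T : Plane ≃ₜ Plane := shear (fun _ => 1) continuous_const

/-- The twist `T₁ (x, y) = (x + 2 - y, y)`. -/
def T₁ : Plane ≃ₜ Plane := shear (fun y => 2 - y) (by continuity)

/-- The twist `T₂ (x, y) = (x + y - 1, y)`. -/
def T₂ : Plane ≃ₜ Plane := shear (fun y => y - 1) (by continuity)

/-- The model Reeb homeomorphism `R₀ = T₁ ∘ T₂⁻¹`, `R₀ (x, y) = (x + 3 - 2y, y)`. -/
def R₀ : Plane ≃ₜ Plane := shear (fun y => 3 - 2 * y) (by continuity)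

/-- The Euclidean norm on the plane. -/
noncomputable def planeNorm (p : Plane) : ℝ := Real.sqrt (p.1 ^ 2 + p.2 ^ 2)

/-- An angle function for a fixed point free map `h'` along a curve `γ`. -/
def IsAngleFunction (h' : Plane → Plane) (γ : ℝ → Plane) (θ : ℝ → ℝ) : Prop :=
  ContinuousOn θ (Icc 0 1) ∧
    ∀ t ∈ Icc (0:ℝ) 1,
      h' (γ t) - γ t =
        planeNorm (h' (γ t) - γ t) • (Real.cos (θ t), Real.sin (θ t))

/-- The conjugate `Φ ∘ h ∘ Φ⁻¹`. -/
def conjH (Φ h : Plane ≃ₜ Plane) : Plane ≃ₜ Plane := Φ.symm.trans (h.trans Φ)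

/-- An admissible straightening `Φ` for `(h, O₁, O₂)` : an orientation preserving
homeomorphism sending `O₁, O₂` to `ℤ₁, ℤ₂` such that `Φ ∘ h ∘ Φ⁻¹` is isotopic
relative to `ℤ₁ ∪ ℤ₂` to a homeomorphism translating each line `ℝ × {i}` by `±1`. -/
def AdmissibleStraightening (h : Plane ≃ₜ Plane) (O₁ O₂ : Set Plane)
    (Φ : Plane ≃ₜ Plane) : Prop :=
  OrientationPreserving Φ ∧ Φ '' O₁ = Z1 ∧ Φ '' O₂ = Z2 ∧
    ∃ ε₁ ε₂ : ℝ, (ε₁ = 1 ∨ ε₁ = -1) ∧ (ε₂ = 1 ∨ ε₂ = -1) ∧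
      ∃ g : Plane ≃ₜ Plane,
        (∀ x : ℝ, g (x, 1) = (x + ε₁, 1)) ∧
        (∀ x : ℝ, g (x, 2) = (x + ε₂, 2)) ∧
        IsotopicRel (⇑(conjH Φ h)) (⇑g) (Z1 ∪ Z2)

/-- A flow on the plane. -/
def IsFlow (φ : ℝ → Plane → Plane) : Prop :=
  Continuous (fun p : ℝ × Plane => φ p.1 p.2) ∧
    (∀ x, φ 0 x = x) ∧ ∀ s t x, φ (s + t) x = φ s (φ t x)

/-- A topological line in the plane: the image of a proper injective continuous
map from `ℝ` to the plane. -/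
def IsTopLine (L : Set Plane) : Prop :=
  ∃ f : ℝ → Plane, Continuous f ∧ Function.Injective f ∧ IsProperMap f ∧ range f = L

open Topology Filter

section Kister

theorem exists_orderIso_shrink {ε a b : ℝ} (hε : 0 < ε) (hεa : ε < a) (hab : a < b) :
    ∃ f : ℝ ≃o ℝ, f 0 = 0 ∧ f a ≤ ε ∧ ∀ u, b ≤ u → f u = u := by
  have ha : 0 < a := hε.trans hεa
  have hba : 0 < b - a := sub_pos.2 hab
  set k : ℝ := (b - ε) / (b - a) with hk
  have hk1 : 1 < k := by rw [hk, one_lt_div hba]; linarith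
  have hkm : k * (b - a) = b - ε := div_mul_cancel₀ _ hba.ne'
  set c : ℝ := ε / a with hc
  have hc0 : 0 < c := div_pos hε ha
  have hca : c * a = ε := div_mul_cancel₀ _ ha.ne'
  let F : ℝ → ℝ := fun u => min u (max (c * u) (b + k * (u - b)))
  have hmono : StrictMono F := by
    intro u v huv
    refine min_lt_min huv (max_lt_max ?_ ?_) <;> nlinarith
  have htop : ∀ u, b ≤ u → F u = u := by
    intro u hu
    refine min_eq_left (le_max_of_le_right ?_)
    nlinarith
  have hsurj : Function.Surjective F := by
    refine Continuous.surjective (by fun_prop) ?_ ?_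
    · exact tendsto_id.congr' ((eventually_ge_atTop b).mono fun u hu => (htop u hu).symm)
    · exact tendsto_atBot_mono (fun u => min_le_left _ _) tendsto_id
  refine ⟨hmono.orderIsoOfSurjective F hsurj, ?_, ?_, htop⟩
  · have : max (c * 0) (b + k * (0 - b)) = 0 := by
      rw [mul_zero]; exact max_eq_left (by nlinarith)
    change min 0 (max (c * 0) (b + k * (0 - b))) = 0
    rw [this, min_self]
  · refine (min_le_right _ _).trans (max_le hca.le ?_)
    nlinarith

theorem exists_orderIso_stretch {r r' : ℝ} (hr : 0 < r) (hrr' : r < r') (c : ℝ) :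
    ∃ f : ℝ ≃o ℝ, f 0 = 0 ∧ (∀ u, u ≤ r → f u = u) ∧ c ≤ f r' := by
  have h : 0 < r' - r := sub_pos.2 hrr'
  set k : ℝ := 1 + |c| / (r' - r) with hk
  have hk1 : 1 ≤ k := le_add_of_nonneg_right (by positivity)
  have hkm : k * (r' - r) = (r' - r) + |c| := by
    rw [hk, add_mul, one_mul, div_mul_cancel₀ _ h.ne']
  let F : ℝ → ℝ := fun u => max u (r + k * (u - r))
  have hmono : StrictMono F := by
    intro u v huv
    refine max_lt_max huv ?_
    nlinarith
  have hbot : ∀ u, u ≤ r → F u = u := by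
    intro u hu
    refine max_eq_left ?_
    nlinarith
  have hsurj : Function.Surjective F := by
    refine Continuous.surjective (by fun_prop) ?_ ?_
    · exact tendsto_atTop_mono (fun u => le_max_left _ _) tendsto_id
    · exact tendsto_id.congr' ((eventually_le_atBot r).mono fun u hu => (hbot u hu).symm)
  refine ⟨hmono.orderIsoOfSurjective F hsurj, hbot 0 hr.le, hbot, ?_⟩
  refine le_trans ?_ (le_max_right _ _)
  rw [hkm]
  linarith [le_abs_self c]

theorem isCompact_norm_snd_le {P E : Type*} [TopologicalSpace P] [CompactSpace P]
    [NormedAddCommGroup E] [ProperSpace E] (r : ℝ) :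
    IsCompact {x : P × E | ‖x.2‖ ≤ r} := by
  convert isCompact_univ.prod (isCompact_closedBall (0 : E) r) using 1
  · ext x
    simp
  · infer_instance

theorem exists_norm_snd_le_subset {P E : Type*} [TopologicalSpace P] [CompactSpace P]
    [NormedAddCommGroup E] {U : Set (P × E)} (hU : IsOpen U) (h0 : ∀ s, (s, 0) ∈ U) :
    ∃ ρ > 0, {x : P × E | ‖x.2‖ ≤ ρ} ⊆ U := by
  obtain ⟨u, v, -, hv, hu, hv0, huv⟩ := generalized_tube_lemma (isCompact_univ (X := P))
    (isCompact_singleton (x := (0 : E))) hU (by rintro ⟨s, x⟩ ⟨-, rfl⟩; exact h0 s)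
  obtain ⟨ρ, hρ, hρv⟩ := Metric.nhds_basis_closedBall.mem_iff.1
    (hv.mem_nhds (Set.singleton_subset_iff.1 hv0))
  exact ⟨ρ, hρ, fun x hx => huv ⟨hu trivial, hρv (by simpa using hx)⟩⟩

variable {E : Type*} [NormedAddCommGroup E] [NormedSpace ℝ E]

theorem orderIso_nonneg {f : ℝ ≃o ℝ} (hf : f 0 = 0) {u : ℝ} (hu : 0 ≤ u) : 0 ≤ f u :=
  hf ▸ f.monotone hu

theorem norm_radial {f : ℝ ≃o ℝ} (hf : f 0 = 0) (x : E) : ‖(f ‖x‖ / ‖x‖) • x‖ = f ‖x‖ := by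
  rcases eq_or_ne x 0 with rfl | hx
  · simp [hf]
  · have := orderIso_nonneg hf (norm_nonneg x)
    rw [norm_smul, Real.norm_of_nonneg (by positivity), div_mul_cancel₀ _ (norm_ne_zero_iff.2 hx)]

theorem continuous_radial {f : ℝ ≃o ℝ} (hf : f 0 = 0) :
    Continuous fun x : E => (f ‖x‖ / ‖x‖) • x := by
  have hc : Continuous fun x : E => f ‖x‖ := f.continuous.comp continuous_norm
  refine continuous_iff_continuousAt.2 fun x => ?_
  rcases eq_or_ne x 0 with rfl | hx
  · rw [ContinuousAt, smul_zero, tendsto_zero_iff_norm_tendsto_zero]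
    simp only [norm_radial hf]
    simpa [hf] using hc.tendsto 0
  · exact (hc.continuousAt.div continuous_norm.continuousAt (norm_ne_zero_iff.2 hx)).smul
      continuousAt_id

theorem radial_symm_radial {f : ℝ ≃o ℝ} (hf : f 0 = 0) (x : E) :
    (f.symm ‖(f ‖x‖ / ‖x‖) • x‖ / ‖(f ‖x‖ / ‖x‖) • x‖) • (f ‖x‖ / ‖x‖) • x = x := by
  rcases eq_or_ne x 0 with rfl | hx
  · simp
  · have hx' : ‖x‖ ≠ 0 := norm_ne_zero_iff.2 hx
    have hfx : f ‖x‖ ≠ 0 := fun h => hx' (f.injective (h.trans hf.symm))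
    rw [norm_radial hf, f.symm_apply_apply, smul_smul, div_mul_div_comm, mul_comm,
      div_self (mul_ne_zero hfx hx'), one_smul]

/-- The radial homeomorphism rescaling norms by `f`. -/
noncomputable def radialHomeo (f : ℝ ≃o ℝ) (hf : f 0 = 0) : E ≃ₜ E :=
  have hf' : f.symm 0 = 0 := f.symm_apply_eq.2 hf.symm
  { toFun := fun x => (f ‖x‖ / ‖x‖) • x
    invFun := fun x => (f.symm ‖x‖ / ‖x‖) • x
    left_inv := radial_symm_radial hf
    right_inv := radial_symm_radial hf'
    continuous_toFun := continuous_radial hf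
    continuous_invFun := continuous_radial hf' }

theorem norm_radialHomeo (f : ℝ ≃o ℝ) (hf : f 0 = 0) (x : E) :
    ‖radialHomeo f hf x‖ = f ‖x‖ := norm_radial hf x

theorem radialHomeo_eq_self (f : ℝ ≃o ℝ) (hf : f 0 = 0) {x : E} (hx : f ‖x‖ = ‖x‖) :
    radialHomeo f hf x = x := by
  change (f ‖x‖ / ‖x‖) • x = x
  rcases eq_or_ne x 0 with rfl | h
  · simp
  · rw [hx, div_self (norm_ne_zero_iff.2 h), one_smul]

/-- A homeomorphism supported in a compact set can be pushed forward by an open embedding. -/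
theorem exists_homeomorph_extend {X Y : Type*} [TopologicalSpace X] [TopologicalSpace Y]
    [T2Space Y] {g : X → Y} (hg : IsOpenEmbedding g) {K : Set X} (hK : IsCompact K)
    (τ : X ≃ₜ X) (hτ : ∀ x ∉ K, τ x = x) :
    ∃ θ : Y ≃ₜ Y, (∀ x, θ (g x) = g (τ x)) ∧ ∀ y ∉ g '' K, θ y = y := by
  have key : ∀ τ : X ≃ₜ X, (∀ x ∉ K, τ x = x) →
      Continuous (Function.extend g (g ∘ τ) id) ∧
      ∀ y ∉ g '' K, Function.extend g (g ∘ τ) id y = y := by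
    intro τ hτ
    have hid : ∀ y ∉ g '' K, Function.extend g (g ∘ τ) id y = y := by
      intro y hy
      by_cases h : ∃ x, g x = y
      · obtain ⟨x, rfl⟩ := h
        rw [hg.injective.extend_apply, Function.comp_apply, hτ x fun hx => hy ⟨x, hx, rfl⟩]
      · rw [Function.extend_apply' _ _ _ h, id]
    refine ⟨continuous_iff_continuousAt.2 fun y => ?_, hid⟩
    by_cases h : ∃ x, g x = y
    · obtain ⟨x, rfl⟩ := h
      rw [← hg.continuousAt_iff, Function.extend_comp hg.injective]
      exact (hg.continuous.comp τ.continuous).continuousAt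
    · have hy : y ∈ (g '' K)ᶜ := fun ⟨x, _, hx⟩ => h ⟨x, hx⟩
      refine continuousAt_id.congr ?_
      filter_upwards [(hK.image hg.continuous).isClosed.isOpen_compl.mem_nhds hy] with z hz
      exact (hid z hz).symm
  have hτ' : ∀ x ∉ K, τ.symm x = x := fun x hx => τ.symm_apply_eq.2 (hτ x hx).symm
  have hinv : ∀ τ : X ≃ₜ X, ∀ y, Function.extend g (g ∘ τ.symm) id
      (Function.extend g (g ∘ τ) id y) = y := by
    intro τ y
    by_cases h : ∃ x, g x = y
    · obtain ⟨x, rfl⟩ := h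
      simp [hg.injective.extend_apply]
    · simp [Function.extend_apply' _ _ _ h]
  refine ⟨⟨⟨Function.extend g (g ∘ τ) id, Function.extend g (g ∘ τ.symm) id, hinv τ,
    hinv τ.symm⟩, (key τ hτ).1, (key τ.symm hτ').1⟩, fun x => ?_, (key τ hτ).2⟩
  exact hg.injective.extend_apply _ _ _

variable {P : Type*} [TopologicalSpace P] [CompactSpace P] [T2Space P]

/-- One step of Kister's expansion process. -/
theorem exists_homeomorph_expand [ProperSpace E] {g : P × E → P × E} (hg : IsOpenEmbedding g)
    (hfst : ∀ x, (g x).1 = x.1) (h0 : ∀ s, g (s, 0) = (s, 0)) {a b : ℝ} (ha : 0 < a)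
    (hab : a < b) (R : ℝ) :
    ∃ φ : (P × E) ≃ₜ (P × E), (∀ x, (φ x).1 = x.1) ∧ (∀ x, ‖x.2‖ ≤ a → φ (g x) = g x) ∧
      ∀ y, ‖y.2‖ ≤ R → ∃ x, ‖x.2‖ ≤ b ∧ φ (g x) = y := by
  have hK := isCompact_norm_snd_le (P := P) (E := E) b
  obtain ⟨c, hcR, hc⟩ : ∃ c, R ≤ c ∧ ∀ x, ‖x.2‖ ≤ b → ‖(g x).2‖ ≤ c := by
    obtain ⟨C, hC⟩ := hK.exists_bound_of_continuousOn
      (continuous_snd.comp hg.continuous).continuousOn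
    exact ⟨max R C, le_max_left _ _, fun x hx => (hC x hx).trans (le_max_right _ _)⟩
  obtain ⟨ρ, hρ, hρg⟩ : ∃ ρ > 0, {x : P × E | ‖x.2‖ ≤ ρ} ⊆ g '' {x | ‖x.2‖ < b} := by
    refine exists_norm_snd_le_subset (hg.isOpenMap _ ?_)
      fun s => ⟨(s, 0), by simpa using ha.trans hab, h0 s⟩
    exact isOpen_lt (by fun_prop) continuous_const
  obtain ⟨ε, hε, hεa, hεg⟩ : ∃ ε > 0, ε < a ∧ ∀ x, ‖x.2‖ ≤ ε → ‖(g x).2‖ ≤ ρ / 2 := by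
    obtain ⟨δ, hδ, h⟩ := exists_norm_snd_le_subset (P := P) (E := E)
      (U := {x | ‖(g x).2‖ < ρ / 2})
      (isOpen_lt (continuous_snd.comp hg.continuous).norm continuous_const)
      fun s => by simpa [h0 s] using hρ
    refine ⟨min δ (a / 2), by positivity, ?_, fun x hx => (h (hx.trans (min_le_left _ _))).le⟩
    exact (min_le_right _ _).trans_lt (by linarith)
  obtain ⟨f, hf0, hfa, hfb⟩ := exists_orderIso_shrink hε hεa hab
  obtain ⟨k, hk0, hkρ, hkc⟩ := exists_orderIso_stretch (half_pos hρ) (half_lt_self hρ) c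
  let τ : (P × E) ≃ₜ (P × E) := (Homeomorph.refl P).prodCongr (radialHomeo f hf0)
  let σ : (P × E) ≃ₜ (P × E) := (Homeomorph.refl P).prodCongr (radialHomeo k hk0)
  have hτn : ∀ x, ‖(τ x).2‖ = f ‖x.2‖ := fun x => norm_radialHomeo f hf0 x.2
  have hσn : ∀ x, ‖(σ x).2‖ = k ‖x.2‖ := fun x => norm_radialHomeo k hk0 x.2
  have hσid : ∀ x, ‖x.2‖ ≤ ρ / 2 → σ x = x := fun x hx =>
    Prod.ext rfl (radialHomeo_eq_self k hk0 (hkρ _ hx))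
  obtain ⟨θ, hθg, hθ⟩ := exists_homeomorph_extend hg hK τ fun x hx =>
    Prod.ext rfl (radialHomeo_eq_self f hf0 (hfb _ (not_le.1 hx).le))
  have hθ1 : ∀ x, (θ x).1 = x.1 := by
    intro x
    by_cases hx : x ∈ g '' {x | ‖x.2‖ ≤ b}
    · obtain ⟨z, -, rfl⟩ := hx
      rw [hθg, hfst, hfst]
      rfl
    · rw [hθ x hx]
  have hθc : ∀ y, ‖y.2‖ ≤ c → ‖(θ y).2‖ ≤ c := by
    intro y hy
    by_cases h : y ∈ g '' {x | ‖x.2‖ ≤ b}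
    · obtain ⟨z, hz, rfl⟩ := h
      rw [hθg]
      refine hc _ ?_
      rw [hτn, ← hfb b le_rfl]
      exact f.monotone hz
    · rwa [hθ y h]
  refine ⟨(θ.trans σ).trans θ.symm, fun x => ?_, fun x hx => ?_, fun y hy => ?_⟩
  · have := hθ1 (θ.symm (σ (θ x)))
    rw [θ.apply_symm_apply] at this
    exact this.symm.trans (hθ1 x)
  · change θ.symm (σ (θ (g x))) = g x
    rw [θ.symm_apply_eq, hθg]
    refine hσid _ (hεg _ ?_)
    rw [hτn]
    exact (f.monotone hx).trans hfa
  · -- pull `y` back through `θ`, `σ` and `θ.symm`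
    set w := σ.symm (θ y) with hw
    have hwρ : ‖w.2‖ ≤ ρ := by
      refine k.le_iff_le.1 ?_
      rw [← hσn, hw, σ.apply_symm_apply]
      exact (hθc y (hy.trans hcR)).trans hkc
    obtain ⟨z, hz, hzw⟩ := hρg hwρ
    refine ⟨τ.symm z, ?_, ?_⟩
    · refine f.le_iff_le.1 ?_
      rw [← hτn, τ.apply_symm_apply, hfb b le_rfl]
      exact hz.le
    · change θ.symm (σ (θ (g (τ.symm z)))) = y
      rw [hθg, τ.apply_symm_apply, hzw, hw, σ.apply_symm_apply, θ.symm_apply_apply]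

/-- **Kister's theorem**: a compact family of open embeddings `E → E` fixing the origin agrees
near the origin with a family of homeomorphisms. -/
theorem exists_isHomeomorph_eqOn_of_isOpenEmbedding [ProperSpace E] {g : P × E → P × E}
    (hg : IsOpenEmbedding g) (hfst : ∀ x, (g x).1 = x.1) (h0 : ∀ s, g (s, 0) = (s, 0)) :
    ∃ H : P × E → P × E, IsHomeomorph H ∧ (∀ x, (H x).1 = x.1) ∧
      ∀ x, ‖x.2‖ ≤ 1 → H x = g x := by
  let S := {g : P × E → P × E // IsOpenEmbedding g ∧ (∀ x, (g x).1 = x.1) ∧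
    ∀ s, g (s, 0) = (s, 0)}
  have step : ∀ (n : ℕ) (g : S), ∃ g' : S, (∀ x, ‖x.2‖ ≤ n + 1 → g'.1 x = g.1 x) ∧
      ∀ y, ‖y.2‖ ≤ (n : ℝ) → ∃ x, ‖x.2‖ ≤ (n : ℝ) + 2 ∧ g'.1 x = y := by
    rintro n ⟨g, hg, hfst, h0⟩
    have hn : (0 : ℝ) < n + 1 := by positivity
    obtain ⟨φ, hφ1, hφ, hφs⟩ := exists_homeomorph_expand hg hfst h0 hn
      (b := n + 2) (by linarith) n
    refine ⟨⟨φ ∘ g, φ.isOpenEmbedding.comp hg, fun x => (hφ1 _).trans (hfst x), fun s => ?_⟩,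
      hφ, hφs⟩
    exact (hφ (s, 0) (by simpa using hn.le)).trans (h0 s)
  choose next hnext hsurj using step
  let G : ℕ → S := fun n => Nat.rec ⟨g, hg, hfst, h0⟩ (fun n g => next n g) n
  have hG : ∀ n, G (n + 1) = next n (G n) := fun n => rfl
  have hstab : ∀ n m : ℕ, n ≤ m → ∀ x : P × E, ‖x.2‖ ≤ n + 1 → (G m).1 x = (G n).1 x := by
    intro n m hnm x hx
    induction m, hnm using Nat.le_induction with
    | base => rfl
    | succ m hnm ih =>
      rw [hG, hnext _ _ x (hx.trans (by exact_mod_cast Nat.succ_le_succ hnm)), ih]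
  let H : P × E → P × E := fun x => (G ⌈‖x.2‖⌉₊).1 x
  have hH : ∀ (n : ℕ) (x : P × E), ‖x.2‖ ≤ n + 1 → H x = (G n).1 x := by
    intro n x hx
    have h1 : ‖x.2‖ ≤ ⌈‖x.2‖⌉₊ := Nat.le_ceil _
    rcases le_total n ⌈‖x.2‖⌉₊ with h | h
    · exact hstab _ _ h x hx
    · exact (hstab _ _ h x (h1.trans (by linarith))).symm
  have hloc : ∀ x, ∃ n, H =ᶠ[𝓝 x] (G n).1 := by
    intro x
    refine ⟨⌈‖x.2‖⌉₊, ?_⟩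
    have : IsOpen {z : P × E | ‖z.2‖ < ⌈‖x.2‖⌉₊ + 1} := isOpen_lt (by fun_prop) continuous_const
    filter_upwards [this.mem_nhds (x := x) ((Nat.le_ceil ‖x.2‖).trans_lt (lt_add_one _))]
      with z hz using hH _ z (le_of_lt hz)
  refine ⟨H, ⟨continuous_iff_continuousAt.2 fun x => ?_, IsOpenMap.of_nhds_le fun x => ?_, ?_, ?_⟩,
    fun x => (G _).2.2.1 x, fun x hx => ?_⟩
  · obtain ⟨n, hn⟩ := hloc x
    exact (G n).2.1.continuous.continuousAt.congr hn.symm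
  · obtain ⟨n, hn⟩ := hloc x
    rw [map_congr hn, hn.eq_of_nhds]
    exact (G n).2.1.isOpenMap.nhds_le x
  · intro x y hxy
    obtain ⟨n, hn⟩ := exists_nat_ge (max ‖x.2‖ ‖y.2‖)
    rw [hH n x ((le_max_left _ _).trans (hn.trans (by linarith))),
      hH n y ((le_max_right _ _).trans (hn.trans (by linarith)))] at hxy
    exact (G n).2.1.injective hxy
  · intro y
    obtain ⟨n, hn⟩ := exists_nat_ge ‖y.2‖
    obtain ⟨x, hx, hxy⟩ := hsurj n (G n) y hn
    exact ⟨x, (hH (n + 1) x (by push_cast; linarith)).trans hxy⟩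
  · exact hH 0 x (by simpa using hx)

end Kister

section Isotopy

theorem isOpenEmbedding_prodMk_of_fiberwise {P E : Type*} [TopologicalSpace P]
    [NormedAddCommGroup E] [NormedSpace ℝ E] [ProperSpace E] {e : P × E → E} (he : Continuous e)
    (hinj : ∀ s, Function.Injective fun x => e (s, x)) (hopen : ∀ s, IsOpenMap fun x => e (s, x)) :
    IsOpenEmbedding fun x : P × E => (x.1, e x) := by
  refine .of_continuous_injective_isOpenMap (by fun_prop) ?_ (IsOpenMap.of_nhds_le ?_)
  · rintro ⟨s, x⟩ ⟨t, y⟩ h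
    obtain ⟨rfl : s = t, h : e (s, x) = e (s, y)⟩ := Prod.ext_iff.1 h
    rw [hinj s h]
  · rintro ⟨s₀, x₀⟩ U hU
    obtain ⟨V, hV, W, hW, hVW⟩ := mem_nhds_prod_iff.1 (mem_map.1 hU)
    obtain ⟨r, hr, hrW⟩ := Metric.nhds_basis_closedBall.mem_iff.1 hW
    set y₀ := e (s₀, x₀) with hy₀
    obtain ⟨ρ, hρ, hρS⟩ : ∃ ρ > 0, ∀ x ∈ Metric.sphere x₀ r, ρ < ‖e (s₀, x) - y₀‖ := by
      obtain ⟨ρ, hρ, h⟩ := (isCompact_sphere x₀ r).exists_forall_le' (a := 0)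
        (f := fun x => ‖e (s₀, x) - y₀‖) (by fun_prop) fun x hx => by
          refine norm_pos_iff.2 (sub_ne_zero.2 fun h => ?_)
          have : x = x₀ := hinj s₀ h
          rw [this, mem_sphere_iff_norm, sub_self, norm_zero] at hx
          exact hr.ne hx
      exact ⟨ρ / 2, half_pos hρ, fun x hx => (half_lt_self hρ).trans_le (h x hx)⟩
    have hev : ∀ᶠ s in 𝓝 s₀, ∀ x ∈ Metric.sphere x₀ r, ρ < ‖e (s, x) - y₀‖ := by
      refine (isCompact_sphere x₀ r).eventually_forall_of_forall_eventually fun x hx => ?_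
      have hc : Continuous fun p : P × E => ‖e p - y₀‖ := by fun_prop
      exact (hc.tendsto (s₀, x)).eventually (lt_mem_nhds (hρS x hx))
    have hev' : ∀ᶠ s in 𝓝 s₀, e (s, x₀) ∈ Metric.ball y₀ ρ := by
      have hc : Continuous fun s => e (s, x₀) := by fun_prop
      exact (hc.tendsto s₀).eventually (Metric.ball_mem_nhds _ hρ)
    refine mem_of_superset (prod_mem_nhds (inter_mem hV (inter_mem hev hev'))
      (Metric.ball_mem_nhds y₀ hρ)) ?_
    rintro ⟨s, y⟩ ⟨⟨hsV, hs, hs'⟩, hy⟩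
    have hsub : Metric.ball y₀ ρ ⊆ (fun x => e (s, x)) '' Metric.ball x₀ r := by
      refine (convex_ball y₀ ρ).isPreconnected.subset_of_closure_inter_subset
        (hopen s _ Metric.isOpen_ball) ⟨_, hs', x₀, Metric.mem_ball_self hr, rfl⟩ ?_
      rintro z ⟨hz, hzB⟩
      have hcl : IsClosed ((fun x => e (s, x)) '' Metric.closedBall x₀ r) :=
        ((isCompact_closedBall x₀ r).image (by fun_prop)).isClosed
      obtain ⟨x, hx, rfl⟩ := closure_minimal (image_mono Metric.ball_subset_closedBall) hcl hz
      rcases (Metric.mem_closedBall.1 hx).lt_or_eq with h | h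
      · exact ⟨x, h, rfl⟩
      · exact absurd (mem_ball_iff_norm.1 hzB) (hs x h).not_gt
    obtain ⟨x, hx, rfl⟩ := hsub hy
    exact hVW (show (s, x) ∈ V ×ˢ W from ⟨hsV, hrW (Metric.ball_subset_closedBall hx)⟩)

/-- A continuous family of homeomorphisms of `E` indexed by the unit interval. -/
def IsIsotopy {E : Type*} [TopologicalSpace E] (G : unitInterval × E → E) : Prop :=
  Continuous G ∧ ∀ s, IsHomeomorph fun x => G (s, x)

namespace IsIsotopy

variable {E : Type*} [TopologicalSpace E] {G G' : unitInterval × E → E}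

theorem comp (hG : IsIsotopy G) (hG' : IsIsotopy G') : IsIsotopy fun x => G (x.1, G' x) :=
  ⟨hG.1.comp (continuous_fst.prodMk hG'.1), fun s => (hG.2 s).comp (hG'.2 s)⟩

theorem const (e : E ≃ₜ E) : IsIsotopy fun x : unitInterval × E => e x.2 :=
  ⟨e.continuous.comp continuous_snd, fun _ => e.isHomeomorph⟩

theorem of_isHomeomorph {H : unitInterval × E → unitInterval × E} (hH : IsHomeomorph H)
    (hfst : ∀ x, (H x).1 = x.1) : IsIsotopy fun x => (H x).2 := by
  obtain ⟨h, rfl⟩ := isHomeomorph_iff_exists_homeomorph.1 hH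
  have hsymm : ∀ x, (h.symm x).1 = x.1 := fun x => by rw [← hfst, h.apply_symm_apply]
  have key : ∀ k : unitInterval × E ≃ₜ unitInterval × E, (∀ x, (k x).1 = x.1) →
      ∀ s x, k.symm (s, (k (s, x)).2) = (s, x) := fun k hk s x =>
    k.symm_apply_eq.2 (Prod.ext (hk (s, x)).symm rfl)
  refine ⟨continuous_snd.comp h.continuous, fun s => isHomeomorph_iff_exists_inverse.2
    ⟨by fun_prop, fun x => (h.symm (s, x)).2, fun x => ?_, fun x => ?_, by fun_prop⟩⟩
  · simp [key h hfst]
  · have := key h.symm hsymm s x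
    rw [h.symm_symm] at this
    exact congrArg Prod.snd this

end IsIsotopy

/-- **Alexander trick**: a homeomorphism that is the identity near the origin is isotopic to the
identity. -/
theorem exists_isIsotopy_of_eqOn_closedBall {E : Type*} [NormedAddCommGroup E] [NormedSpace ℝ E]
    (A : E ≃ₜ E) (hA : ∀ x, ‖x‖ ≤ 1 → A x = x) :
    ∃ G : unitInterval × E → E, IsIsotopy G ∧ (∀ x, G (0, x) = x) ∧ ∀ x, G (1, x) = A x := by
  let G : unitInterval × E → E := fun x =>
    if x.1 = 0 then x.2 else (x.1 : ℝ)⁻¹ • A ((x.1 : ℝ) • x.2)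
  have hG0 : ∀ x, G (0, x) = x := fun x => if_pos rfl
  have hG : ∀ x : unitInterval × E, x.1 ≠ 0 → G x = (x.1 : ℝ)⁻¹ • A ((x.1 : ℝ) • x.2) :=
    fun x hx => if_neg hx
  have hcoe : ∀ s : unitInterval, s ≠ 0 → (s : ℝ) ≠ 0 := fun s hs h => hs (Subtype.ext h)
  refine ⟨G, ⟨continuous_iff_continuousAt.2 fun x => ?_, fun s => ?_⟩, hG0, fun x => ?_⟩
  · by_cases hx : x.1 = 0
    · refine continuous_snd.continuousAt.congr ?_
      have hU : IsOpen {y : unitInterval × E | ‖(y.1 : ℝ) • y.2‖ < 1} :=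
        isOpen_lt (by fun_prop) continuous_const
      filter_upwards [hU.mem_nhds (x := x) (by simp [hx])] with y hy
      by_cases h : y.1 = 0
      · exact (if_pos h).symm
      · rw [hG y h, hA _ (le_of_lt hy), inv_smul_smul₀ (hcoe _ h)]
    · have hU : IsOpen {y : unitInterval × E | y.1 ≠ 0} := isOpen_ne_fun continuous_fst
        continuous_const
      have hc : ContinuousAt (fun y : unitInterval × E => (y.1 : ℝ)⁻¹ • A ((y.1 : ℝ) • y.2)) x := by
        have h1 : ContinuousAt (fun y : unitInterval × E => (y.1 : ℝ)) x := by fun_prop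
        have h2 : Continuous (fun y : unitInterval × E => A ((y.1 : ℝ) • y.2)) := by fun_prop
        exact (h1.inv₀ (hcoe _ hx)).smul h2.continuousAt
      refine hc.congr ?_
      filter_upwards [hU.mem_nhds hx] with y hy using (hG y hy).symm
  · by_cases hs : s = 0
    · subst hs
      simp only [hG0]
      exact IsHomeomorph.id
    · have : (fun x => G (s, x)) = fun x => (s : ℝ)⁻¹ • A ((s : ℝ) • x) :=
        funext fun x => hG (s, x) hs
      rw [this]
      let D := Homeomorph.smulOfNeZero (s : ℝ) (α := E) (hcoe s hs)
      exact ((D.trans A).trans D.symm).isHomeomorph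
  · rw [hG _ one_ne_zero]
    simp

/-- If `φ` is a homeomorphism of `ℂ` which through `exp` looks like a homeomorphism isotopic to the
identity, then `φ` is isotopic to the identity fixing the origin. -/
theorem exists_isIsotopy_of_exp_semiconj {f : unitInterval × ℂ → ℂ} (hf : IsIsotopy f)
    (hf0 : ∀ z, f (0, z) = z) (φ : ℂ ≃ₜ ℂ) (hφ0 : φ 0 = 0)
    (hφ : ∀ z, φ (Complex.exp z) = Complex.exp (f (1, z))) :
    ∃ G : unitInterval × ℂ → ℂ, IsIsotopy G ∧ (∀ z, G (0, z) = z) ∧ (∀ z, G (1, z) = φ z) ∧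
      ∀ s, G (s, 0) = 0 := by
  obtain ⟨δ, hδ, hδf⟩ := exists_norm_snd_le_subset (P := unitInterval) (E := ℂ)
    (U := {x | ‖f x - f (x.1, 0)‖ < Real.pi})
    (isOpen_lt (by have := hf.1; fun_prop) continuous_const)
    fun s => by simpa using Real.pi_pos
  let κ := OpenPartialHomeomorph.univBall (0 : ℂ) δ
  have hκ0 : κ 0 = 0 := OpenPartialHomeomorph.univBall_apply_zero 0 δ
  have hκ : IsOpenEmbedding κ :=
    κ.isOpenEmbedding (OpenPartialHomeomorph.univBall_source 0 δ)
  have hκδ : ∀ z, ‖κ z‖ ≤ δ := fun z => by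
    have : κ z ∈ κ.target := κ.map_source (by simp [κ])
    rw [OpenPartialHomeomorph.univBall_target 0 hδ] at this
    simpa using (Metric.ball_subset_closedBall this)
  let e : unitInterval × ℂ → ℂ := fun x => Complex.exp (f (x.1, κ x.2) - f (x.1, 0)) - 1
  have hκf : ∀ s z, ‖f (s, κ z) - f (s, 0)‖ < Real.pi := fun s z =>
    hδf (show ‖(s, κ z).2‖ ≤ δ from hκδ z)
  have he : IsOpenEmbedding fun x : unitInterval × ℂ => (x.1, e x) := by
    refine isOpenEmbedding_prodMk_of_fiberwise ?_ (fun s => ?_) fun s => ?_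
    · have := hf.1
      have := hκ.continuous
      fun_prop
    · intro z w hzw
      have h1 := fun z => abs_lt.1 ((Complex.abs_im_le_norm _).trans_lt (hκf s z))
      have := Complex.exp_inj_of_neg_pi_lt_of_le_pi (h1 z).1 (h1 z).2.le (h1 w).1 (h1 w).2.le
        (sub_left_injective hzw)
      exact hκ.injective ((hf.2 s).injective (sub_left_injective this))
    · exact ((Homeomorph.subRight (1 : ℂ)).isOpenMap.comp Complex.isOpenMap_exp).comp
        ((Homeomorph.subRight (f (s, 0))).isOpenMap.comp ((hf.2 s).isOpenMap.comp hκ.isOpenMap))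
  obtain ⟨H, hH, hH1, hHe⟩ := exists_isHomeomorph_eqOn_of_isOpenEmbedding he (fun _ => rfl)
    fun s => by simp [e, hκ0]
  have hHi := IsIsotopy.of_isHomeomorph hH hH1
  obtain ⟨h₀, hh₀⟩ := isHomeomorph_iff_exists_homeomorph.1 (hHi.2 0)
  obtain ⟨h₁, hh₁⟩ := isHomeomorph_iff_exists_homeomorph.1 (hHi.2 1)
  replace hh₀ : ∀ z, h₀ z = (H (0, z)).2 := fun z => congrFun hh₀ z
  replace hh₁ : ∀ z, h₁ z = (H (1, z)).2 := fun z => congrFun hh₁ z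
  set c := f (1, 0) with hc
  have hc0 := Complex.exp_ne_zero c
  let ψ : ℂ ≃ₜ ℂ := (((Homeomorph.addRight (1 : ℂ)).trans φ).trans
    (Homeomorph.mulRight₀ (Complex.exp c)⁻¹ (inv_ne_zero hc0))).trans (Homeomorph.subRight 1)
  have hψ : ∀ z, ψ z = φ (z + 1) * (Complex.exp c)⁻¹ - 1 := fun z => rfl
  obtain ⟨A, hA, hA0, hA1⟩ := exists_isIsotopy_of_eqOn_closedBall
    ((h₀.trans ψ).trans h₁.symm) fun z hz => by
      change h₁.symm (ψ (h₀ z)) = z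
      rw [h₁.symm_apply_eq, hh₀, hh₁, hHe (0, z) hz, hHe (1, z) hz, hψ]
      simp only [e, hf0, sub_zero, sub_add_cancel, hφ, ← hc]
      rw [Complex.exp_sub, div_eq_mul_inv]
  have hK := (hHi.comp hA).comp (IsIsotopy.const h₀.symm)
  set K : unitInterval × ℂ → ℂ := fun x => (H (x.1, A (x.1, h₀.symm x.2))).2 with hKdef
  replace hK : IsIsotopy K := hK
  have hK0 : ∀ z, K (0, z) = z := fun z => by
    simp only [hKdef, hA0, ← hh₀, h₀.apply_symm_apply]
  have hK1 : ∀ z, K (1, z) = ψ z := fun z => by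
    simp only [hKdef, hA1, ← hh₁]
    simp
  refine ⟨fun x => Complex.exp (((x.1 : ℝ) : ℂ) * c) * (K (x.1, x.2 - 1) - K (x.1, -1)),
    ⟨?_, fun s => ?_⟩, fun z => ?_, fun z => ?_, fun s => ?_⟩
  · have := hK.1
    fun_prop
  · exact (Homeomorph.mulLeft₀ _ (Complex.exp_ne_zero (((s : ℝ) : ℂ) * c))).isHomeomorph.comp
      ((Homeomorph.subRight (K (s, -1))).isHomeomorph.comp
        ((hK.2 s).comp (Homeomorph.subRight (1 : ℂ)).isHomeomorph))
  · simp [hK0]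
  · simp only [hK1, hψ]
    simp only [sub_add_cancel, neg_add_cancel, hφ0]
    simp [mul_comm, hc0]
  · simp

theorem apply_add_int_mul_of_apply_add {R : Type*} [Ring R] {f : R → R} {c : R}
    (h : ∀ z, f (z + c) = f z + c) (n : ℤ) (z : R) : f (z + n * c) = f z + n * c := by
  induction n with
  | zero => simp
  | succ n ih =>
    push_cast at ih ⊢
    rw [add_one_mul, ← add_assoc, h, ih, add_assoc]
  | pred n ih =>
    push_cast at ih ⊢
    have := h (z + (-n - 1) * c)
    rw [add_assoc, ← add_one_mul, sub_add_cancel, ih] at this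
    rw [eq_sub_of_add_eq this.symm, sub_one_mul, add_sub_assoc]

/-- An isotopy of `ℂ` fixing the origin lifts through `exp`. -/
theorem exists_isIsotopy_lift {G : unitInterval × ℂ → ℂ} (hG : IsIsotopy G)
    (hG0 : ∀ z, G (0, z) = z) (hGz : ∀ s, G (s, 0) = 0) :
    ∃ Γ : unitInterval × ℂ → ℂ, IsIsotopy Γ ∧ (∀ z, Γ (0, z) = z) ∧
      (∀ s z, Complex.exp (Γ (s, z)) = G (s, Complex.exp z)) ∧
      ∀ s z, Γ (s, z + 2 * Real.pi * Complex.I) = Γ (s, z) + 2 * Real.pi * Complex.I := by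
  have cov := Complex.isCoveringMap_exp
  have hGc := hG.1
  let Hc : C(unitInterval × ℂ, {z : ℂ // z ≠ 0}) :=
    ⟨fun x => ⟨G (x.1, Complex.exp x.2), fun h =>
      Complex.exp_ne_zero x.2 ((hG.2 x.1).injective (h.trans (hGz x.1).symm))⟩, by fun_prop⟩
  have H0 : ∀ z : ℂ, Hc (0, z) = ⟨_, (ContinuousMap.id ℂ z).exp_ne_zero⟩ := fun z =>
    Subtype.ext (hG0 _)
  let Γ := cov.liftHomotopy Hc (ContinuousMap.id ℂ) H0
  have hΓ0 : ∀ z, Γ (0, z) = z := fun z => cov.liftHomotopy_zero Hc (ContinuousMap.id ℂ) H0 z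
  have hΓ : ∀ s z, Complex.exp (Γ (s, z)) = G (s, Complex.exp z) := fun s z =>
    congrArg Subtype.val (congrFun (cov.liftHomotopy_lifts Hc (ContinuousMap.id ℂ) H0) (s, z))
  have hper : ∀ s z, Γ (s, z + 2 * Real.pi * Complex.I) = Γ (s, z) + 2 * Real.pi * Complex.I := by
    let Γ' : C(unitInterval × ℂ, ℂ) :=
      ⟨fun x => Γ (x.1, x.2 + 2 * Real.pi * Complex.I) - 2 * Real.pi * Complex.I, by fun_prop⟩
    have : Γ' = Γ := by
      refine (cov.eq_liftHomotopy_iff' H0 Γ').2 ⟨?_, fun z => ?_⟩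
      · ext x
        simp [Γ', Hc, hΓ, Complex.exp_sub, Complex.exp_add]
      · simp [Γ', hΓ0]
    intro s z
    rw [← sub_eq_iff_eq_add]
    exact DFunLike.congr_fun this (s, z)
  have hperZ : ∀ (n : ℤ) s z, Γ (s, z + n * (2 * Real.pi * Complex.I)) =
      Γ (s, z) + n * (2 * Real.pi * Complex.I) := fun n s =>
    apply_add_int_mul_of_apply_add (f := fun z => Γ (s, z)) (hper s) n
  refine ⟨Γ, ⟨Γ.continuous, fun s => ?_⟩, hΓ0, hΓ, hper⟩
  have hexp : IsLocalHomeomorph Complex.exp :=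
    (isOpen_ne (x := (0 : ℂ))).isOpenEmbedding_subtypeVal.isLocalHomeomorph.comp
      cov.isLocalHomeomorph
  have hcont : Continuous fun z => Γ (s, z) := by fun_prop
  have hopen : IsOpenMap fun z => Γ (s, z) := by
    have hcomp : IsLocalHomeomorph (Complex.exp ∘ fun z => Γ (s, z)) := by
      obtain ⟨g, hg⟩ := isHomeomorph_iff_exists_homeomorph.1 (hG.2 s)
      have : (Complex.exp ∘ fun z => Γ (s, z)) = g ∘ Complex.exp := by
        ext1 z
        simp [hΓ, hg]
      rw [this]
      exact g.isLocalHomeomorph.comp hexp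
    exact (hcomp.of_comp hexp hcont).isOpenMap
  refine ⟨hcont, hopen, fun z w h => ?_, fun w => ?_⟩
  · have h' : Complex.exp z = Complex.exp w := by
      refine (hG.2 s).injective ?_
      rw [← hΓ, ← hΓ]
      exact congrArg _ h
    obtain ⟨n, rfl⟩ := Complex.exp_eq_exp_iff_exists_int.1 h'
    have : Γ (s, w + n * (2 * Real.pi * Complex.I)) = Γ (s, w) := h
    rw [hperZ, add_eq_left] at this
    rw [this, add_zero]
  · obtain ⟨u, hu⟩ := (hG.2 s).surjective (Complex.exp w)
    have hu0 : u ≠ 0 := by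
      rintro rfl
      exact Complex.exp_ne_zero w (hu.symm.trans (hGz s))
    have h' : Complex.exp w = Complex.exp (Γ (s, Complex.log u)) := by
      rw [hΓ, Complex.exp_log hu0]
      exact hu.symm
    obtain ⟨n, hn⟩ := Complex.exp_eq_exp_iff_exists_int.1 h'
    exact ⟨Complex.log u + n * (2 * Real.pi * Complex.I), (hperZ n s _).trans hn.symm⟩

end Isotopy

section Ends

/-- `Ψ` descends to an injective map of the cylinder `ℂ / 2πiℤ`. -/
def DescendsToCylinder (Ψ : ℂ → ℂ) : Prop :=
  ∀ z w, Complex.exp (Ψ z) = Complex.exp (Ψ w) ↔ Complex.exp z = Complex.exp w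

/-- `Ψ` sends the left end of the plane to the left end. -/
def FixesLeftEnd (Ψ : ℂ → ℂ) : Prop :=
  ∀ M : ℝ, ∃ C : ℝ, ∀ z : ℂ, z.re < C → (Ψ z).re < M

theorem re_eq_of_exp_eq {z w : ℂ} (h : Complex.exp z = Complex.exp w) : z.re = w.re := by
  have := congrArg norm h
  rwa [Complex.norm_exp, Complex.norm_exp, Real.exp_eq_exp] at this

namespace DescendsToCylinder

variable {Ψ : ℂ ≃ₜ ℂ}

protected theorem symm (hΨ : DescendsToCylinder Ψ) : DescendsToCylinder Ψ.symm := fun z w => by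
  rw [← hΨ, Ψ.apply_symm_apply, Ψ.apply_symm_apply]

protected theorem neg {Ψ : ℂ → ℂ} (hΨ : DescendsToCylinder Ψ) :
    DescendsToCylinder fun z => -Ψ z := fun z w => by
  simp only [← hΨ z w]
  rw [Complex.exp_neg, Complex.exp_neg, inv_inj]

theorem exists_lt_abs_re (hΨ : DescendsToCylinder Ψ) (M : ℝ) :
    ∃ C : ℝ, ∀ z : ℂ, z.re < C → M < |(Ψ z).re| := by
  have hK : IsCompact (Icc (-M) M ×ℂ Icc (-Real.pi) Real.pi) := isCompact_Icc.reProdIm isCompact_Icc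
  obtain ⟨C, hC⟩ := hK.exists_bound_of_continuousOn
    (f := fun w => (Ψ.symm w).re) (by fun_prop)
  refine ⟨-C, fun z hz => ?_⟩
  by_contra! h
  set w := Complex.log (Complex.exp (Ψ z)) with hw
  have hexp : Complex.exp w = Complex.exp (Ψ z) := Complex.exp_log (Complex.exp_ne_zero _)
  have hwK : w ∈ Icc (-M) M ×ℂ Icc (-Real.pi) Real.pi := by
    refine ⟨?_, (Complex.neg_pi_lt_log_im _).le, Complex.log_im_le_pi _⟩
    rw [mem_preimage, re_eq_of_exp_eq hexp]
    exact abs_le.1 h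
  have hre : (Ψ.symm w).re = z.re := by
    refine re_eq_of_exp_eq ?_
    rw [← hΨ, Ψ.apply_symm_apply, hexp]
  have := hC w hwK
  rw [hre, Real.norm_eq_abs] at this
  linarith [(abs_le.1 this).1]

theorem fixesLeftEnd_or (hΨ : DescendsToCylinder Ψ) :
    FixesLeftEnd Ψ ∨ FixesLeftEnd fun z => -Ψ z := by
  obtain ⟨C₀, hC₀⟩ := hΨ.exists_lt_abs_re 0
  have hpre : IsPreconnected ((fun z => (Ψ z).re) '' {z : ℂ | z.re < C₀}) :=
    (convex_halfSpace_re_lt C₀).isPreconnected.image _ (by fun_prop)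
  have hne : ∀ z : ℂ, z.re < C₀ → (Ψ z).re ≠ 0 := fun z hz => abs_pos.1 (hC₀ z hz)
  have hsign : (∀ z : ℂ, z.re < C₀ → (Ψ z).re < 0) ∨ ∀ z : ℂ, z.re < C₀ → 0 < (Ψ z).re := by
    by_contra! h
    obtain ⟨⟨z, hz, hz0⟩, w, hw, hw0⟩ := h
    obtain ⟨u, hu, hu0⟩ := hpre.ordConnected.out ⟨w, hw, rfl⟩ ⟨z, hz, rfl⟩ ⟨hw0, hz0⟩
    exact hne u hu hu0
  refine hsign.imp (fun h M => ?_) fun h M => ?_ <;>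
  · obtain ⟨C, hC⟩ := hΨ.exists_lt_abs_re (-M)
    refine ⟨min C C₀, fun z hz => ?_⟩
    have h1 := hC z (hz.trans_le (min_le_left _ _))
    have h2 := h z (hz.trans_le (min_le_right _ _))
    simp only [abs_of_neg, abs_of_pos, h2, Complex.neg_re] at h1 ⊢
    linarith

end DescendsToCylinder

theorem FixesLeftEnd.symm {Ψ : ℂ ≃ₜ ℂ} (hΨ : DescendsToCylinder Ψ) (h : FixesLeftEnd Ψ) :
    FixesLeftEnd Ψ.symm := by
  refine hΨ.symm.fixesLeftEnd_or.resolve_right fun h' => ?_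
  obtain ⟨C', hC'⟩ := h' 0
  obtain ⟨C, hC⟩ := h C'
  have h1 := hC' _ (hC ((min C 0 - 1 : ℝ) : ℂ) (by
    rw [Complex.ofReal_re]; linarith [min_le_left C 0]))
  simp only [Ψ.symm_apply_apply, Complex.neg_re, Complex.ofReal_re] at h1
  linarith [min_le_right C 0]

/-- The map of `ℂ` fixing the origin that `Ψ` induces through `exp`. -/
noncomputable def expConj (Ψ : ℂ → ℂ) (w : ℂ) : ℂ :=
  if w = 0 then 0 else Complex.exp (Ψ (Complex.log w))

theorem expConj_zero (Ψ : ℂ → ℂ) : expConj Ψ 0 = 0 := if_pos rfl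

theorem expConj_exp {Ψ : ℂ → ℂ} (hΨ : DescendsToCylinder Ψ) (z : ℂ) :
    expConj Ψ (Complex.exp z) = Complex.exp (Ψ z) := by
  rw [expConj, if_neg (Complex.exp_ne_zero z), hΨ, Complex.exp_log (Complex.exp_ne_zero z)]

theorem continuous_expConj {Ψ : ℂ → ℂ} (hc : Continuous Ψ) (hΨ : DescendsToCylinder Ψ)
    (h : FixesLeftEnd Ψ) : Continuous (expConj Ψ) := by
  refine continuous_iff_continuousAt.2 fun w => ?_
  rcases eq_or_ne w 0 with rfl | hw
  · rw [ContinuousAt, expConj_zero, Metric.tendsto_nhds_nhds]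
    intro ε hε
    obtain ⟨C, hC⟩ := h (Real.log ε)
    refine ⟨Real.exp C, Real.exp_pos C, fun {w} hw => ?_⟩
    rw [dist_zero_right] at hw ⊢
    rcases eq_or_ne w 0 with rfl | h0
    · rwa [expConj_zero, norm_zero]
    · rw [expConj, if_neg h0, Complex.norm_exp, ← Real.lt_log_iff_exp_lt hε]
      refine hC _ ?_
      rwa [Complex.log_re, Real.log_lt_iff_lt_exp (norm_pos_iff.2 h0)]
  · rw [← Complex.exp_log hw, ContinuousAt, expConj_exp hΨ]
    have hle : 𝓝 (Complex.exp (Complex.log w)) ≤ map Complex.exp (𝓝 (Complex.log w)) :=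
      Complex.isOpenMap_exp.nhds_le _
    refine Tendsto.mono_left (tendsto_map'_iff.2 ?_) hle
    have : expConj Ψ ∘ Complex.exp = fun z => Complex.exp (Ψ z) := funext (expConj_exp hΨ)
    rw [this]
    exact (Complex.continuous_exp.comp hc).tendsto _

theorem expConj_symm_expConj {Ψ : ℂ ≃ₜ ℂ} (hΨ : DescendsToCylinder Ψ) (w : ℂ) :
    expConj Ψ.symm (expConj Ψ w) = w := by
  rcases eq_or_ne w 0 with rfl | hw
  · rw [expConj_zero, expConj_zero]
  · rw [← Complex.exp_log hw, expConj_exp hΨ, expConj_exp hΨ.symm, Ψ.symm_apply_apply]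

theorem exists_homeomorph_exp_semiconj {Ψ : ℂ ≃ₜ ℂ} (hΨ : DescendsToCylinder Ψ)
    (h : FixesLeftEnd Ψ) :
    ∃ φ : ℂ ≃ₜ ℂ, φ 0 = 0 ∧ ∀ z, φ (Complex.exp z) = Complex.exp (Ψ z) :=
  ⟨⟨⟨expConj Ψ, expConj Ψ.symm, expConj_symm_expConj hΨ, expConj_symm_expConj hΨ.symm⟩,
    continuous_expConj Ψ.continuous hΨ h,
    continuous_expConj Ψ.symm.continuous hΨ.symm (h.symm hΨ)⟩,
    expConj_zero Ψ, expConj_exp hΨ⟩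

/-- A homeomorphism isotopic to the identity, descending to the cylinder and fixing its left end,
is up to a deck transformation isotopic to the identity through periodic homeomorphisms. -/
theorem exists_periodic_isIsotopy {f : unitInterval × ℂ → ℂ} (hf : IsIsotopy f)
    (hf0 : ∀ z, f (0, z) = z) (hΨ : DescendsToCylinder fun z => f (1, z))
    (h : FixesLeftEnd fun z => f (1, z)) :
    ∃ Γ : unitInterval × ℂ → ℂ, IsIsotopy Γ ∧ (∀ z, Γ (0, z) = z) ∧
      (∀ s z, Γ (s, z + 2 * Real.pi * Complex.I) = Γ (s, z) + 2 * Real.pi * Complex.I) ∧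
      ∃ n : ℤ, ∀ z, Γ (1, z) = f (1, z) + n * (2 * Real.pi * Complex.I) := by
  obtain ⟨Ψ, hΨf⟩ := isHomeomorph_iff_exists_homeomorph.1 (hf.2 1)
  rw [← hΨf] at hΨ h
  replace hΨf : ∀ z, f (1, z) = Ψ z := fun z => (congrFun hΨf z).symm
  obtain ⟨φ, hφ0, hφ⟩ := exists_homeomorph_exp_semiconj hΨ h
  obtain ⟨G, hG, hG0, hG1, hGz⟩ := exists_isIsotopy_of_exp_semiconj hf hf0 φ hφ0
    fun z => by rw [hφ, hΨf]
  obtain ⟨Γ, hΓ, hΓ0, hΓe, hΓp⟩ := exists_isIsotopy_lift hG hG0 hGz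
  have hexp : ∀ z, Complex.exp (Γ (1, z)) = Complex.exp (Ψ z) := fun z => by
    rw [hΓe, hG1, hφ]
  obtain ⟨n, hn⟩ := Complex.exp_eq_exp_iff_exists_int.1 (hexp 0)
  refine ⟨Γ, hΓ, hΓ0, hΓp, n, fun z => ?_⟩
  rw [hΨf]
  refine congrFun (Complex.isCoveringMap_exp.eq_of_comp_eq (g₁ := fun z => Γ (1, z))
    (g₂ := fun z => Ψ z + n * (2 * Real.pi * Complex.I)) (hΓ.2 1).continuous (by fun_prop)
    (funext fun z => Subtype.ext ?_) 0 hn) z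
  refine (hexp z).trans (Complex.exp_eq_exp_iff_exists_int.2 ⟨-n, ?_⟩)
  push_cast
  ring

end Ends

theorem isHomeoFun_iff_isHomeomorph {f : Plane → Plane} : IsHomeoFun f ↔ IsHomeomorph f := by
  rw [isHomeomorph_iff_exists_homeomorph]
  exact exists_congr fun e => funext_iff.symm

/-- The linear identification of the plane with `ℂ` conjugating `T` to translation by `2πi`. -/
noncomputable def planeToComplex : Plane ≃ₜ ℂ where
  toFun p := p.2 + p.1 * (2 * Real.pi * Complex.I)
  invFun z := (z.im / (2 * Real.pi), z.re)
  left_inv p := by simp [Real.pi_ne_zero]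
  right_inv z := by
    push_cast
    rw [← mul_assoc, div_mul_cancel₀ _ (by simp), Complex.re_add_im]
  continuous_toFun := by fun_prop
  continuous_invFun := by fun_prop

theorem planeToComplex_T (p : Plane) :
    planeToComplex (T p) = planeToComplex p + 2 * Real.pi * Complex.I := by
  change ((p.2 : ℝ) : ℂ) + ((p.1 + 1 : ℝ) : ℂ) * (2 * Real.pi * Complex.I) =
    p.2 + p.1 * (2 * Real.pi * Complex.I) + 2 * Real.pi * Complex.I
  push_cast
  ring

theorem descendsToCylinder_of_periodic {Ψ : ℂ → ℂ} (hinj : Function.Injective Ψ)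
    (hΨ : ∀ z, Ψ (z + 2 * Real.pi * Complex.I) = Ψ z + 2 * Real.pi * Complex.I) :
    DescendsToCylinder Ψ := by
  have hZ : ∀ (n : ℤ) z, Ψ (z + n * (2 * Real.pi * Complex.I)) =
      Ψ z + n * (2 * Real.pi * Complex.I) := apply_add_int_mul_of_apply_add hΨ
  intro z w
  rw [Complex.exp_eq_exp_iff_exists_int, Complex.exp_eq_exp_iff_exists_int]
  refine exists_congr fun n => ?_
  rw [← hZ, hinj.eq_iff]

/-- Connectedness of the centralizer of the translation:
every orientation preserving homeomorphism commuting with `T` is isotopic to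
the identity through homeomorphisms commuting with `T`. -/
theorem translation_centralizer_connected
    (Φ : Plane ≃ₜ Plane) (hOP : OrientationPreserving Φ)
    (hcomm : ∀ p, Φ (T p) = T (Φ p)) :
    ∃ F : ℝ × Plane → Plane, Continuous F ∧
      (∀ x, F (0, x) = x) ∧ (∀ x, F (1, x) = Φ x) ∧
      ∀ t ∈ Icc (0:ℝ) 1,
        IsHomeoFun (fun x => F (t, x)) ∧ ∀ p, F (t, T p) = T (F (t, p)) := by
  set L := planeToComplex with hL
  have hLT : ∀ p, L (T p) = L p + 2 * Real.pi * Complex.I := planeToComplex_T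
  have hLT' : ∀ z, L.symm (z + 2 * Real.pi * Complex.I) = T (L.symm z) := fun z => by
    rw [L.symm_apply_eq, hLT, L.apply_symm_apply]
  obtain ⟨F, hFc, hFh, hF0, hF1, -⟩ := hOP
  let f : unitInterval × ℂ → ℂ := fun x => L (F (x.1, L.symm x.2))
  have hf : IsIsotopy f := ⟨by fun_prop, fun s => L.isHomeomorph.comp
    ((isHomeoFun_iff_isHomeomorph.1 (hFh s s.2)).comp L.symm.isHomeomorph)⟩
  have hf0 : ∀ z, f (0, z) = z := fun z => by simp [f, hF0]
  have hf1 : ∀ z, f (1, z) = L (Φ (L.symm z)) := fun z => by simp [f, hF1]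
  have hper : ∀ z, f (1, z + 2 * Real.pi * Complex.I) = f (1, z) + 2 * Real.pi * Complex.I :=
    fun z => by rw [hf1, hf1, hLT', hcomm, hLT]
  have hcyl : DescendsToCylinder fun z => f (1, z) :=
    descendsToCylinder_of_periodic (hf.2 1).injective hper
  obtain ⟨Ψ, hΨ⟩ := isHomeomorph_iff_exists_homeomorph.1 (hf.2 1)
  have hends : (FixesLeftEnd fun z => f (1, z)) ∨ FixesLeftEnd fun z => -f (1, z) := by
    rw [← hΨ] at hcyl
    simpa only [← congrFun hΨ] using hcyl.fixesLeftEnd_or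
  rcases hends with h | h
  · obtain ⟨Γ, hΓ, hΓ0, hΓp, n, hn⟩ := exists_periodic_isIsotopy hf hf0 hcyl h
    have hΓc := hΓ.1
    let pr : ℝ → unitInterval := projIcc 0 1 zero_le_one
    have hpr : Continuous pr := continuous_projIcc
    have hpr0 : pr 0 = 0 := projIcc_left zero_le_one
    have hpr1 : pr 1 = 1 := projIcc_right zero_le_one
    refine ⟨fun x => L.symm (Γ (pr x.1, L x.2) -
      ((pr x.1 : ℝ) : ℂ) * (n * (2 * Real.pi * Complex.I))), by fun_prop, fun x => ?_, fun x => ?_,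
      fun t _ => ⟨isHomeoFun_iff_isHomeomorph.2 ?_, fun p => ?_⟩⟩
    · simp [hpr0, hΓ0]
    · simp [hpr1, hn, hf1]
    · exact L.symm.isHomeomorph.comp ((Homeomorph.subRight
        (((pr t : ℝ) : ℂ) * (n * (2 * Real.pi * Complex.I)))).isHomeomorph.comp
        ((hΓ.2 (pr t)).comp L.isHomeomorph))
    · simp only
      rw [hLT, hΓp, add_sub_right_comm, hLT']
  · exfalso
    -- rotating by a half turn makes the reversal of ends incompatible with periodicity
    let f' : unitInterval × ℂ → ℂ := fun x =>
      Complex.exp (((x.1 : ℝ) : ℂ) * (Real.pi * Complex.I)) * f x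
    have hfc := hf.1
    have hf' : IsIsotopy f' := ⟨by fun_prop, fun s =>
      (Homeomorph.mulLeft₀ (Complex.exp (((s : ℝ) : ℂ) * (Real.pi * Complex.I)))
        (Complex.exp_ne_zero _)).isHomeomorph.comp (hf.2 s)⟩
    have hf'1 : ∀ z, f' (1, z) = -f (1, z) := fun z => by simp [f', Complex.exp_pi_mul_I]
    obtain ⟨Γ, -, -, hΓp, n, hn⟩ := exists_periodic_isIsotopy hf'
      (fun z => by simp [f', hf0]) (by simpa only [hf'1] using hcyl.neg)
      (by simpa only [hf'1] using h)
    have h1 := hΓp 1 0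
    rw [hn, hn, hf'1, hf'1, hper] at h1
    have : (2 * Real.pi * Complex.I : ℂ) = 0 := by linear_combination -h1 / 2
    exact Complex.two_pi_I_ne_zero this
end

section
/- Invariance of the index under isotopy through fixed point free homeomorphisms: let F : [0,1] × ℝ² → ℝ² be continuous and such that for every t ∈ [0,1], the map h_t := F(t,·) is a homeomorphism of ℝ² without fixed points satisfying h_t(ℤ₁) = ℤ₁ and h_t(ℤ₂) = ℤ₂. Let γ : [0,1] → ℝ² be a continuous curve with γ(0) ∈ ℤ₁ and γ(1) ∈ ℤ₂, let θ₀ be an angle function for h₀ along γ and θ₁ an angle function for h₁ along γ. Then θ₀(1) − θ₀(0) = θ₁(1) − θ₁(0). -/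
open Set

open unitInterval

/-- A continuous logarithm of a constant function on a connected space is constant. -/
lemma eq_of_exp_const {X : Type*} [TopologicalSpace X] [PreconnectedSpace X] {f : X → ℂ}
    (hf : Continuous f) (hexp : ∀ x y, Complex.exp (f x) = Complex.exp (f y)) (x y : X) :
    f x = f y :=
  Complex.isCoveringMap_exp.isSeparatedMap.const_of_comp
    Complex.isCoveringMap_exp.isLocalHomeomorph.isLocallyInjective hf
    (fun a b => Subtype.ext (hexp a b)) x y

/-- The quotient of a homotopy of nonvanishing functions by its initial function has a
continuous logarithm. -/
lemma exists_log_homotopy {A : Type*} [TopologicalSpace A] (G : C(I × A, ℂ))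
    (hG : ∀ x, G x ≠ 0) :
    ∃ L : C(I × A, ℂ), (∀ a, L (0, a) = 0) ∧
      ∀ s a, G (s, a) = Complex.exp (L (s, a)) * G (0, a) := by
  let H : C(I × A, {z : ℂ // z ≠ 0}) :=
    ⟨fun x => ⟨G x / G (0, x.2), div_ne_zero (hG _) (hG _)⟩,
      (G.continuous.div (by fun_prop) fun x => hG _).subtype_mk _⟩
  have H_zero : ∀ a, H (0, a) = ⟨_, (0 : ℂ).exp_ne_zero⟩ := fun a =>
    Subtype.ext (by simp [H, div_self (hG _)])
  let L := Complex.isCoveringMap_exp.liftHomotopy H (ContinuousMap.const A 0) H_zero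
  refine ⟨L, fun a => Complex.isCoveringMap_exp.liftHomotopy_zero H _ H_zero a, fun s a => ?_⟩
  have h := congrArg Subtype.val
    (congrFun (Complex.isCoveringMap_exp.liftHomotopy_lifts H (ContinuousMap.const A 0) H_zero) (s, a))
  change Complex.exp (L (s, a)) = G (s, a) / G (0, a) at h
  rw [h, div_mul_cancel₀ _ (hG _)]

/-- A continuous map from a connected space to a horizontal integer lattice line is constant. -/
lemma eq_of_mem_int_line {X : Type*} [TopologicalSpace X] [PreconnectedSpace X] {f : X → Plane}
    (hf : Continuous f) {c : ℝ} (hmem : ∀ x, ∃ n : ℤ, f x = ((n : ℝ), c)) (x y : X) :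
    f x = f y := by
  have hexp : ∀ x, Complex.exp (((f x).1 : ℂ) * (2 * Real.pi * Complex.I)) = 1 := fun x => by
    obtain ⟨n, hn⟩ := hmem x
    rw [hn]
    simp [Complex.exp_int_mul_two_pi_mul_I n]
  have h := eq_of_exp_const (f := fun x => ((f x).1 : ℂ) * (2 * Real.pi * Complex.I))
    (by fun_prop) (fun x y => (hexp x).trans (hexp y).symm) x y
  have h1 : (f x).1 = (f y).1 := by
    exact_mod_cast mul_right_cancel₀ Complex.two_pi_I_ne_zero h
  obtain ⟨m, hm⟩ := hmem x
  obtain ⟨n, hn⟩ := hmem y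
  exact Prod.ext h1 (by rw [hm, hn])

lemma planeNorm_ne_zero {p : Plane} (hp : p ≠ 0) : planeNorm p ≠ 0 := by
  intro h
  rw [planeNorm, Real.sqrt_eq_zero (by positivity)] at h
  exact hp (Prod.ext (by simp; nlinarith [sq_nonneg p.1, sq_nonneg p.2])
    (by simp; nlinarith [sq_nonneg p.1, sq_nonneg p.2]))

lemma planeNorm_pos {p : Plane} (hp : p ≠ 0) : 0 < planeNorm p :=
  (Real.sqrt_nonneg _).lt_of_ne' (planeNorm_ne_zero hp)

/-- Polar coordinates as a complex exponential. -/
lemma equivRealProdCLM_symm_eq_exp {p : Plane} (hp : p ≠ 0) {θ : ℝ}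
    (hθ : p = planeNorm p • (Real.cos θ, Real.sin θ)) :
    Complex.equivRealProdCLM.symm p =
      Complex.exp ((Real.log (planeNorm p) : ℝ) + θ * Complex.I) := by
  rw [Complex.exp_add, ← Complex.ofReal_exp, Real.exp_log (planeNorm_pos hp)]
  have h1 := congrArg Prod.fst hθ
  have h2 := congrArg Prod.snd hθ
  apply Complex.ext
  · simpa [Complex.exp_ofReal_mul_I_re] using h1
  · simpa [Complex.exp_ofReal_mul_I_im] using h2

/-- Two continuous families of nonzero plane vectors that are homotopic through such families with
fixed endpoints have the same variation of angle. -/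
lemma angle_variation_eq_of_homotopy {V : I × I → Plane} (hV : Continuous V)
    (hne : ∀ x, V x ≠ 0) (hleft : ∀ s, V (s, 0) = V (0, 0)) (hright : ∀ s, V (s, 1) = V (0, 1))
    {α β : I → ℝ} (hα : Continuous α) (hβ : Continuous β)
    (hVα : ∀ t, V (0, t) = planeNorm (V (0, t)) • (Real.cos (α t), Real.sin (α t)))
    (hVβ : ∀ t, V (1, t) = planeNorm (V (1, t)) • (Real.cos (β t), Real.sin (β t))) :
    α 1 - α 0 = β 1 - β 0 := by
  let G : C(I × I, ℂ) :=
    ⟨fun x => Complex.equivRealProdCLM.symm (V x), Complex.equivRealProdCLM.symm.continuous.comp hV⟩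
  have hG : ∀ x, G x ≠ 0 := fun x => by simpa [G] using hne x
  obtain ⟨L, L_zero, hL⟩ := exists_log_homotopy G hG
  have L_end : ∀ t, (∀ s, V (s, t) = V (0, t)) → L (1, t) = 0 := fun t ht => by
    have hexp : ∀ s, Complex.exp (L (s, t)) = 1 := fun s => by
      have h := hL s t
      have hGt : G (s, t) = G (0, t) := congrArg Complex.equivRealProdCLM.symm (ht s)
      rw [hGt] at h
      exact (mul_eq_right₀ (hG _)).mp h.symm
    rw [← L_zero t]
    exact eq_of_exp_const (f := fun s => L (s, t)) (by fun_prop)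
      (fun x y => (hexp x).trans (hexp y).symm) 1 0
  have hnorm : ∀ s, Continuous fun t => Real.log (planeNorm (V (s, t))) := fun s => by
    refine Continuous.log ?_ fun t => planeNorm_ne_zero (hne _)
    unfold planeNorm
    fun_prop
  let w : I → ℂ := fun t =>
    (Real.log (planeNorm (V (1, t))) : ℝ) + β t * Complex.I
      - ((Real.log (planeNorm (V (0, t))) : ℝ) + α t * Complex.I) - L (1, t)
  have hw : Continuous w := by
    have := hnorm 0
    have := hnorm 1
    fun_prop
  have hexp : ∀ t, Complex.exp (w t) = 1 := fun t => by
    have h := hL 1 t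
    simp only [w, Complex.exp_sub, ← equivRealProdCLM_symm_eq_exp (hne _) (hVα t),
      ← equivRealProdCLM_symm_eq_exp (hne _) (hVβ t)]
    change G (1, t) / G (0, t) / _ = 1
    rw [h, mul_div_cancel_right₀ _ (hG _), div_self (Complex.exp_ne_zero _)]
  have h := congrArg Complex.im
    (eq_of_exp_const hw (fun x y => (hexp x).trans (hexp y).symm) 1 0)
  simp only [w, L_end 0 hleft, L_end 1 hright] at h
  simp at h
  linarith

/-- Invariance of the index under isotopy through fixed point
free homeomorphisms preserving `ℤ₁` and `ℤ₂`. -/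
theorem index_invariant_under_fpf_isotopy
    (F : ℝ × Plane → Plane) (hF : Continuous F)
    (hhomeo : ∀ t ∈ Icc (0:ℝ) 1, IsHomeoFun fun x => F (t, x))
    (hfpf : ∀ t ∈ Icc (0:ℝ) 1, ∀ x, F (t, x) ≠ x)
    (hZ1 : ∀ t ∈ Icc (0:ℝ) 1, (fun x => F (t, x)) '' Z1 = Z1)
    (hZ2 : ∀ t ∈ Icc (0:ℝ) 1, (fun x => F (t, x)) '' Z2 = Z2)
    (γ : ℝ → Plane) (hγ : ContinuousOn γ (Icc 0 1))
    (hγ0 : γ 0 ∈ Z1) (hγ1 : γ 1 ∈ Z2)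
    (θ₀ θ₁ : ℝ → ℝ)
    (hθ₀ : IsAngleFunction (fun x => F (0, x)) γ θ₀)
    (hθ₁ : IsAngleFunction (fun x => F (1, x)) γ θ₁) :
    θ₀ 1 - θ₀ 0 = θ₁ 1 - θ₁ 0 := by
  have hγI : Continuous fun t : I => γ t := hγ.comp_continuous continuous_subtype_val fun t => t.2
  have hFst : Continuous fun x : I × I => F ((x.1 : ℝ), γ x.2) :=
    hF.comp ((continuous_subtype_val.comp continuous_fst).prodMk (hγI.comp continuous_snd))
  have hZ1' : ∀ s s' : I, F ((s : ℝ), γ 0) = F ((s' : ℝ), γ 0) :=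
    eq_of_mem_int_line (f := fun s : I => F ((s : ℝ), γ 0)) (by fun_prop)
      fun s => (hZ1 s s.2).subset (mem_image_of_mem _ hγ0)
  have hZ2' : ∀ s s' : I, F ((s : ℝ), γ 1) = F ((s' : ℝ), γ 1) :=
    eq_of_mem_int_line (f := fun s : I => F ((s : ℝ), γ 1)) (by fun_prop)
      fun s => (hZ2 s s.2).subset (mem_image_of_mem _ hγ1)
  simpa using angle_variation_eq_of_homotopy
    (V := fun x : I × I => F ((x.1 : ℝ), γ x.2) - γ x.2)
    (α := fun t : I => θ₀ t) (β := fun t : I => θ₁ t)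
    (hFst.sub (hγI.comp continuous_snd))
    (fun x => sub_ne_zero.mpr (hfpf x.1 x.1.2 _))
    (fun s => congrArg (· - γ 0) (hZ1' s 0))
    (fun s => congrArg (· - γ 1) (hZ2' s 0))
    (hθ₀.1.comp_continuous continuous_subtype_val fun t => t.2)
    (hθ₁.1.comp_continuous continuous_subtype_val fun t => t.2)
    (fun t => by simpa using hθ₀.2 t t.2) (fun t => by simpa using hθ₁.2 t t.2)
end
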